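/- Let G be a finite simple cubic bridgeless graph, (G_0, G_i, P_i)^l an odd ear decomposition of G, M a perfect matching of G that is absolute in it, i ∈ {1, …, l}, and Q_i a (G_i, M)-ear square graph. Then for every square s_v of Q_i, writing V(s_v) = {v_j : j ∈ Z_4} with edges v_j v_{j+1} for j ∈ Z_4, there exists a unique j ∈ Z_4 such that v_j and v_{j+1} both have degree 4 in Q_i and v_{j+2} and v_{j+3} both have degree 3 in Q_i. -/

import Mathlib

open SimpleGraph

namespace Hex

variable {V : Type}

/-- A graph is cubic (3-regular) if every vertex has exactly 3 neighbors. -/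
def IsCubic (G : SimpleGraph V) : Prop := ∀ v : V, (G.neighborSet v).ncard = 3

/-- A graph is bridgeless if none of its edges is a bridge. -/
def Bridgeless (G : SimpleGraph V) : Prop := ∀ e ∈ G.edgeSet, ¬G.IsBridge e

/-- A valid assignment of the indices `i_{v(u)} ∈ {0,1,2}`: with each neighbor `u` of `v`
an index in `{0,1,2}` is associated, pairwise distinct for distinct neighbors. -/
def GoodIdx (G : SimpleGraph V) (idx : V → V → ZMod 6) : Prop :=
  (∀ v u : V, G.Adj v u → (idx v u).val < 3) ∧
  (∀ v u w : V, G.Adj v u → G.Adj v w → u ≠ w → idx v u ≠ idx v w)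

/-- The pair of white edges `(e_{uv}, e'_{uv})` replacing the edge `uv` of `G`.
A vertex `v_i` belongs to the class `X` iff `i` is even, to `Y` iff `i` is odd. -/
def whitePairs (idx : V → V → ZMod 6) (u v : V) :
    Sym2 (V × ZMod 6) × Sym2 (V × ZMod 6) :=
  if (idx u v).val % 2 = (idx v u).val % 2 then
    (s((u, idx u v), (v, idx v u + 3)), s((u, idx u v + 3), (v, idx v u)))
  else
    (s((u, idx u v), (v, idx v u)), s((u, idx u v + 3), (v, idx v u + 3)))

/-- The white edges of the hexagon graph. -/
def IsWhite (G : SimpleGraph V) (idx : V → V → ZMod 6) (e : Sym2 (V × ZMod 6)) : Prop :=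
  ∃ u v : V, G.Adj u v ∧ (e = (whitePairs idx u v).1 ∨ e = (whitePairs idx u v).2)

/-- The red edges of the hexagon graph: the edges `v_i v_{i+3}`. -/
def IsRed (e : Sym2 (V × ZMod 6)) : Prop :=
  ∃ (v : V) (i : ZMod 6), e = s((v, i), (v, i + 3))

/-- The blue edges of the hexagon graph: the edges `v_i v_{i+1}`. -/
def IsBlue (e : Sym2 (V × ZMod 6)) : Prop :=
  ∃ (v : V) (i : ZMod 6), e = s((v, i), (v, i + 1))

/-- The hexagon graph of `G` with respect to an index assignment `idx`: each vertex `v` of `G`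
is replaced by a hexagon (a copy of `K_{3,3}` with vertex set `{v} × ZMod 6`, and edge set
`{v_i v_{i+1}} ∪ {v_i v_{i+3}}`), and each edge `uv` of `G` is replaced by the two white
edges `e_{uv}`, `e'_{uv}`. -/
def hexagonGraph (G : SimpleGraph V) (idx : V → V → ZMod 6) : SimpleGraph (V × ZMod 6) :=
  SimpleGraph.fromRel fun p q =>
    (p.1 = q.1 ∧ (q.2 = p.2 + 1 ∨ q.2 = p.2 + 3)) ∨ IsWhite G idx s(p, q)

/-- A blue perfect matching of the hexagon graph: a perfect matching all of whose edges
are blue. -/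
def IsBluePM (G : SimpleGraph V) (idx : V → V → ZMod 6)
    (M : (hexagonGraph G idx).Subgraph) : Prop :=
  M.IsPerfectMatching ∧ ∀ e ∈ M.edgeSet, IsBlue e

/-- The graph `M Δ W` on the vertices of the hexagon graph, whose edge set is the symmetric
difference of the edge set of `M` and the set `W` of white edges. Its connected components
are the cycles of `M Δ W`. -/
def sdGraph (G : SimpleGraph V) (idx : V → V → ZMod 6)
    (M : (hexagonGraph G idx).Subgraph) : SimpleGraph (V × ZMod 6) :=
  SimpleGraph.fromEdgeSet (symmDiff M.edgeSet {e | IsWhite G idx e})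

/-- The edge set of the subgraph of `G` induced by the cycle (connected component) `c`
of `M Δ W`: the edges `uv` of `G` such that `e_{uv}` or `e'_{uv}` belongs to `c`. -/
def inducedSet (G : SimpleGraph V) (idx : V → V → ZMod 6)
    (M : (hexagonGraph G idx).Subgraph)
    (c : (sdGraph G idx M).ConnectedComponent) : Set (Sym2 V) :=
  {e | ∃ (u v : V) (i j : ZMod 6), (sdGraph G idx M).Adj (u, i) (v, j) ∧ u ≠ v ∧
    (sdGraph G idx M).connectedComponentMk (u, i) = c ∧ e = s(u, v)}

/-- A rotation system of `G`: for each vertex `v`, a cyclic permutation of the edges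
incident with `v` (encoded on darts with tail `v`). -/
structure RotationSystem (G : SimpleGraph V) where
  σ : G.Dart ≃ G.Dart
  tail_eq : ∀ d : G.Dart, (σ d).toProd.1 = d.toProd.1
  cyclic : ∀ d d' : G.Dart, d.toProd.1 = d'.toProd.1 → ∃ n : ℕ, (⇑σ)^[n] d = d'

/-- The face-traversal map of a rotation system: after traversing the dart `d = (v, w)`,
the next dart is obtained by applying the rotation at `w` to the edge of `d`. -/
def facePerm {G : SimpleGraph V} (ρ : RotationSystem G) : G.Dart → G.Dart :=
  fun d => ρ.σ d.symm

/-- The face boundaries of a rotation system, as edge sets of `G`. -/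
def faceSets {G : SimpleGraph V} (ρ : RotationSystem G) : Set (Set (Sym2 V)) :=
  {S | ∃ d : G.Dart, S = {e | ∃ n : ℕ, ((facePerm ρ)^[n] d).edge = e}}

/-- The cyclic shift `0 ↦ 1 ↦ 2 ↦ 0` on the index set `{0,1,2} ⊂ ZMod 6`. -/
def rot3 (a : ZMod 6) : ZMod 6 := if a = 2 then 0 else a + 1

/-- The cyclic shift `0 ↦ 2 ↦ 1 ↦ 0` on the index set `{0,1,2} ⊂ ZMod 6`. -/
def rot3inv (a : ZMod 6) : ZMod 6 := if a = 0 then 2 else a - 1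

/-- An edge `e` belongs to the cycle (connected component) `c` of a graph `K`. -/
def edgeInComp {W : Type} (K : SimpleGraph W) (e : Sym2 W) (c : K.ConnectedComponent) :
    Prop :=
  e ∈ K.edgeSet ∧ ∀ x ∈ e, K.connectedComponentMk x = c

/-- A blue perfect matching `M` is safe if no cycle of `M Δ W` contains both end vertices
of a red edge, i.e. no component of `M Δ W` contains both `(v, i)` and `(v, i + 3)`. -/
def SafePM (G : SimpleGraph V) (idx : V → V → ZMod 6)
    (M : (hexagonGraph G idx).Subgraph) : Prop :=
  ∀ (v : V) (i : ZMod 6), ¬(sdGraph G idx M).Reachable (v, i) (v, i + 3)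

/-- A directed cycle double cover of `G`: a family of directed cycles (cycles traversed
in a chosen direction) such that every dart of `G` is traversed by exactly one member;
equivalently, every edge lies on exactly two members and they induce opposite
orientations on it. -/
def HasDCDC (G : SimpleGraph V) : Prop :=
  ∃ (ι : Type) (F : ι → Σ v : V, G.Walk v v),
    (∀ i, (F i).2.IsCycle) ∧ ∀ d : G.Dart, ∃! i, d ∈ (F i).2.darts

/-- A brace: a simple connected bipartite graph on at least six vertices that has a
perfect matching and such that every pair of vertex-disjoint edges is contained in a
perfect matching. -/
def IsBrace {W : Type} [Fintype W] (H : SimpleGraph W) : Prop :=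
  H.Connected ∧ H.Colorable 2 ∧ 6 ≤ Fintype.card W ∧
  (∃ M : H.Subgraph, M.IsPerfectMatching) ∧
  ∀ e₁ ∈ H.edgeSet, ∀ e₂ ∈ H.edgeSet, (∀ x ∈ e₁, x ∉ e₂) →
    ∃ M : H.Subgraph, M.IsPerfectMatching ∧ e₁ ∈ M.edgeSet ∧ e₂ ∈ M.edgeSet

/-- The ladder `L_{2n}`: vertices `a_0, …, a_{n-1}, b_0, …, b_{n-1}`, with edges
`a_i a_{i+1}`, `b_i b_{i+1}` (indices mod `n`) and the rungs `a_i b_i`.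
In particular `ladder 4` is the ladder `L_8` on 8 vertices. -/
def ladder (n : ℕ) : SimpleGraph (Fin 2 × ZMod n) :=
  SimpleGraph.fromRel fun p q => (p.1 = q.1 ∧ q.2 = p.2 + 1) ∨ (p.1 ≠ q.1 ∧ p.2 = q.2)

/-- The expansion of a vertex `x` to a path `x¹ v x²`, relative to the part `N1` of a
partition `(N1, N(x) \ N1)` of the neighborhood of `x`: `x` is deleted, the new path
`x¹ v x²` is added (here `v := Sum.inl x`, `x¹ := Sum.inr 0`, `x² := Sum.inr 1`), every
vertex of `N1` is joined to `x¹` and every other neighbor of `x` is joined to `x²`. -/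
def expansion {α : Type} (H : SimpleGraph α) (x : α) (N1 : Set α) :
    SimpleGraph (α ⊕ Fin 2) :=
  SimpleGraph.fromRel fun p q =>
    match p, q with
    | Sum.inl a, Sum.inl b => H.Adj a b ∧ a ≠ x ∧ b ≠ x
    | Sum.inr i, Sum.inl a =>
        (a = x ∧ (i = 0 ∨ i = 1)) ∨ (i = 0 ∧ a ∈ N1 ∧ H.Adj x a) ∨
        (i = 1 ∧ a ∉ N1 ∧ H.Adj x a)
    | _, _ => False

/-- `H'` is obtained from `H` by a type-1 augmentation: one new edge is added so that the
result is bipartite (stated up to isomorphism). -/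
def IsType1Aug {α β : Type} (H : SimpleGraph α) (H' : SimpleGraph β) : Prop :=
  ∃ x y : α, x ≠ y ∧ ¬H.Adj x y ∧
    (SimpleGraph.fromEdgeSet (insert s(x, y) H.edgeSet)).Colorable 2 ∧
    Nonempty (H' ≃g SimpleGraph.fromEdgeSet (insert s(x, y) H.edgeSet))

/-- `H'` is obtained from `H` by a type-2 augmentation: a vertex `x` of degree at least 4
is expanded to `x¹ v x²` (with both parts of the neighborhood partition of size at least 2)
and a new edge `v w` is added, where `w` is a vertex in the same partition class as `x`
(stated up to isomorphism). -/
def IsType2Aug {α β : Type} (H : SimpleGraph α) (H' : SimpleGraph β) : Prop :=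
  ∃ (x w : α) (N1 : Set α),
    4 ≤ (H.neighborSet x).ncard ∧ N1 ⊆ H.neighborSet x ∧ 2 ≤ N1.ncard ∧
    2 ≤ (H.neighborSet x \ N1).ncard ∧ w ≠ x ∧
    (∃ C : H.Coloring (Fin 2), C w = C x) ∧
    Nonempty (H' ≃g SimpleGraph.fromEdgeSet
      (insert s(Sum.inl x, Sum.inl w) (expansion H x N1).edgeSet))

/-- A bundled graph (a graph together with its vertex type). -/
structure BundledGraph : Type 1 where
  carrier : Type
  graph : SimpleGraph carrier

/-- A simple augmentation: a type-1 or a type-2 augmentation. -/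
def IsSimpleAug (A B : BundledGraph) : Prop :=
  IsType1Aug A.graph B.graph ∨ IsType2Aug A.graph B.graph

/-- The set of vertices of the square `s_v` that are covered by an edge of `S`
(for `S` the projection of an edge or path, these are the vertices of its
supporting edge in `s_v`). -/
def sqSupp (v : V) (S : Set (Sym2 (V × ZMod 4))) : Set (V × ZMod 4) :=
  {p | p.1 = v ∧ ∃ e ∈ S, p ∈ e}

/-- An `M`-square graph of `G`: each vertex `v` of `G` is replaced by a square `s_v`
(a copy of `K_{2,2}` on `{v} × ZMod 4`, with edge set `{v_j v_{j+1}}`), and each edge `uv`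
of `G` is replaced by its projection `pr u v`, a set of two edges forming, together with a
supporting edge in each of `s_u`, `s_v`, a copy of `K_{2,2}`; whenever `uv ∈ M` and `w, z`
are the other two neighbors of `v`, the supporting edges of `pr w v` and `pr z v` in `s_v`
are vertex-disjoint. -/
structure SquareGraph (G : SimpleGraph V) (M : Set (Sym2 V)) where
  Q : SimpleGraph (V × ZMod 4)
  pr : V → V → Set (Sym2 (V × ZMod 4))
  bip : Q.Colorable 2
  intra : ∀ (v : V) (j k : ZMod 4), Q.Adj (v, j) (v, k) ↔ (k = j + 1 ∨ j = k + 1)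
  pr_symm : ∀ u v : V, pr u v = pr v u
  pr_shape : ∀ u v : V, G.Adj u v → ∃ j k : ZMod 4,
    pr u v = {s((u, j), (v, k)), s((u, j + 1), (v, k + 1))} ∨
    pr u v = {s((u, j), (v, k)), s((u, j + 1), (v, k + 3))}
  inter : ∀ (u v : V) (j k : ZMod 4), u ≠ v →
    (Q.Adj (u, j) (v, k) ↔ G.Adj u v ∧ s((u, j), (v, k)) ∈ pr u v)
  matched : ∀ v u w z : V, G.Adj v u → G.Adj v w → G.Adj v z → u ≠ w → u ≠ z → w ≠ z →
    s(u, v) ∈ M → Disjoint (sqSupp v (pr w v)) (sqSupp v (pr z v))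

/-- An odd ear decomposition of `G`: a sequence of subgraphs `G_0, …, G_l` where `G_0` is
an even cycle, `G_l = G`, and each `G_i` is obtained from `G_{i-1}` by attaching an odd
path (ear) whose ends lie in `G_{i-1}` and which is otherwise disjoint from `G_{i-1}`. -/
structure OddEarDecomp (G : SimpleGraph V) where
  l : ℕ
  Gs : Fin (l + 1) → G.Subgraph
  base : ∃ (v : V) (c : G.Walk v v), c.IsCycle ∧ Even c.length ∧ Gs 0 = c.toSubgraph
  top : Gs (Fin.last l) = ⊤
  ear : ∀ i : Fin l, ∃ (a b : V) (p : G.Walk a b),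
    p.IsPath ∧ Odd p.length ∧
    a ∈ (Gs i.castSucc).verts ∧ b ∈ (Gs i.castSucc).verts ∧
    (∀ w ∈ p.support, w ≠ a → w ≠ b → w ∉ (Gs i.castSucc).verts) ∧
    (∀ e ∈ p.edges, e ∉ (Gs i.castSucc).edgeSet) ∧
    Gs i.succ = Gs i.castSucc ⊔ p.toSubgraph

/-- A perfect matching `M` of `G` is absolute in an odd ear decomposition if its
restriction to each `G_i` is a perfect matching of `G_i`. -/
def AbsoluteIn {G : SimpleGraph V} (M : G.Subgraph) (D : OddEarDecomp G) : Prop :=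
  ∀ i : Fin (D.l + 1), ∀ v ∈ (D.Gs i).verts, ∃! w : V, M.Adj v w ∧ (D.Gs i).Adj v w

/-- The set `V_3(K)` of vertices of degree 3 in the subgraph `K`. -/
def deg3 {G : SimpleGraph V} (K : G.Subgraph) : Set V :=
  {v | (K.neighborSet v).ncard = 3}

/-- A member of `P(K)`: a path of `K` whose end vertices have degree 3 in `K` and all of
whose internal vertices have degree 2 in `K`. -/
def IsEarPath {G : SimpleGraph V} (K : G.Subgraph) {u v : V} (p : G.Walk u v) : Prop :=
  p.IsPath ∧ 0 < p.length ∧ (∀ e ∈ p.edges, e ∈ K.edgeSet) ∧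
  u ∈ deg3 K ∧ v ∈ deg3 K ∧
  ∀ w ∈ p.support, w ≠ u → w ≠ v → (K.neighborSet w).ncard = 2

/-- A `(K, M)`-ear square graph (for `K` one of the graphs `G_i` of an ear decomposition):
each vertex `v` of degree 3 in `K` is replaced by a square `s_v` on `{v} × ZMod 4` (all
other vertices of the ambient type are isolated), and each path `p(u,v) ∈ P(K)` is
replaced by its projected path `pr p`, a set of two edges forming, together with a
supporting edge in each of `s_u`, `s_v`, a copy of `K_{2,2}`; projected paths of distinct
paths are disjoint; and for every `v ∈ V_3(K)`, the two paths at `v` other than the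
matching-path of `v` have vertex-disjoint supporting edges in `s_v`. -/
structure EarSquareGraph (G : SimpleGraph V) (K : G.Subgraph) (M : Set (Sym2 V)) where
  Q : SimpleGraph (V × ZMod 4)
  pr : ∀ {u v : V}, G.Walk u v → Set (Sym2 (V × ZMod 4))
  bip : Q.Colorable 2
  isolated : ∀ (v : V) (j : ZMod 4) (q : V × ZMod 4), v ∉ deg3 K → ¬Q.Adj (v, j) q
  intra : ∀ v ∈ deg3 K, ∀ j k : ZMod 4, Q.Adj (v, j) (v, k) ↔ (k = j + 1 ∨ j = k + 1)
  pr_symm : ∀ {u v : V} (p : G.Walk u v), pr p.reverse = pr p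
  pr_shape : ∀ {u v : V} (p : G.Walk u v), IsEarPath K p → ∃ j k : ZMod 4,
    pr p = {s((u, j), (v, k)), s((u, j + 1), (v, k + 1))} ∨
    pr p = {s((u, j), (v, k)), s((u, j + 1), (v, k + 3))}
  pr_disjoint : ∀ {u v u' v' : V} (p : G.Walk u v) (q : G.Walk u' v'),
    IsEarPath K p → IsEarPath K q →
    (⟨u, v, p⟩ : Σ a b : V, G.Walk a b) ≠ ⟨u', v', q⟩ →
    (⟨u, v, p⟩ : Σ a b : V, G.Walk a b) ≠ ⟨v', u', q.reverse⟩ →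
    Disjoint (pr p) (pr q)
  inter : ∀ (u v : V) (j k : ZMod 4), u ≠ v →
    (Q.Adj (u, j) (v, k) ↔ ∃ p : G.Walk u v, IsEarPath K p ∧ s((u, j), (v, k)) ∈ pr p)
  matched : ∀ (v y z : V) (q : G.Walk v y) (r : G.Walk v z),
    IsEarPath K q → IsEarPath K r → q.getVert 1 ≠ r.getVert 1 →
    (∀ w : V, s(v, w) ∈ M → q.getVert 1 ≠ w ∧ r.getVert 1 ≠ w) →
    Disjoint (sqSupp v (pr q)) (sqSupp v (pr r))

/-- Every cut of `K` with vertices of `K` on both sides contains at least two edges of `K`. -/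
def TwoEdgeCut {G : SimpleGraph V} (K : G.Subgraph) : Prop :=
  ∀ S : Set V, (∃ x ∈ K.verts, x ∈ S) → (∃ y ∈ K.verts, y ∉ S) →
    ∃ a b a' b' : V, K.Adj a b ∧ K.Adj a' b' ∧ a ∈ S ∧ b ∉ S ∧ a' ∈ S ∧ b' ∉ S ∧
      s(a, b) ≠ s(a', b')

/-- A trail with both ends in `S` that visits the complement of `S` crosses the boundary
of `S` along two distinct edges. -/
lemma exists_two_boundary_edges [DecidableEq V] {G : SimpleGraph V} {u v w : V}
    {p : G.Walk u v} (hp : p.IsTrail) {S : Set V} (hu : u ∈ S) (hv : v ∈ S)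
    (hw : w ∈ p.support) (hwS : w ∉ S) :
    ∃ a b a' b' : V, s(a, b) ∈ p.edges ∧ s(a', b') ∈ p.edges ∧
      a ∈ S ∧ b ∉ S ∧ a' ∈ S ∧ b' ∉ S ∧ s(a, b) ≠ s(a', b') := by
  obtain ⟨d, hd, hd1, hd2⟩ := (p.takeUntil w hw).exists_boundary_dart S hu hwS
  obtain ⟨d', hd', hd1', hd2'⟩ := (p.dropUntil w hw).reverse.exists_boundary_dart S hv hwS
  have he : s(d.fst, d.snd) ∈ (p.takeUntil w hw).edges := List.mem_map_of_mem hd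
  have he' : s(d'.fst, d'.snd) ∈ (p.dropUntil w hw).edges := by
    have : s(d'.fst, d'.snd) ∈ (p.dropUntil w hw).reverse.edges := List.mem_map_of_mem hd'
    simpa using this
  refine ⟨_, _, _, _, p.edges_takeUntil_subset_edges hw he, p.edges_dropUntil_subset_edges hw he',
    hd1, hd2, hd1', hd2', fun h => ?_⟩
  have hn := hp.edges_nodup
  rw [← p.take_spec hw, Walk.edges_append] at hn
  exact List.disjoint_of_nodup_append hn he (h ▸ he')

/-- A trail with both ends on the same side of `S` that visits the other side crosses the
boundary of `S` along two distinct edges. -/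
lemma exists_two_boundary_edges_of_iff [DecidableEq V] {G : SimpleGraph V} {u v w : V}
    {p : G.Walk u v} (hp : p.IsTrail) {S : Set V} (huv : u ∈ S ↔ v ∈ S)
    (hw : w ∈ p.support) (hwS : w ∈ S ↔ u ∉ S) :
    ∃ a b a' b' : V, s(a, b) ∈ p.edges ∧ s(a', b') ∈ p.edges ∧
      a ∈ S ∧ b ∉ S ∧ a' ∈ S ∧ b' ∉ S ∧ s(a, b) ≠ s(a', b') := by
  by_cases hu : u ∈ S
  · exact exists_two_boundary_edges hp hu (huv.1 hu) hw (fun h => hwS.1 h hu)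
  · obtain ⟨a, b, a', b', h, h', ha, hb, ha', hb', hne⟩ :=
      exists_two_boundary_edges (S := Sᶜ) hp hu (fun h => hu (huv.2 h)) hw
        (not_not.2 (hwS.2 hu))
    refine ⟨b, a, b', a', Sym2.eq_swap ▸ h, Sym2.eq_swap ▸ h', not_not.1 hb, ha,
      not_not.1 hb', ha', ?_⟩
    rwa [Sym2.eq_swap, Sym2.eq_swap (a := b')]

/-- The subgraph of a closed trail meets every cut in no edge or in at least two edges. -/
lemma twoEdgeCut_toSubgraph [DecidableEq V] {G : SimpleGraph V} {v : V} {c : G.Walk v v}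
    (hc : c.IsTrail) : TwoEdgeCut c.toSubgraph := by
  rintro S ⟨x, hx, hxS⟩ ⟨y, hy, hyS⟩
  rw [Walk.mem_verts_toSubgraph] at hx hy
  have : ∃ w ∈ c.support, (w ∈ S ↔ v ∉ S) := by
    by_cases hv : v ∈ S
    · exact ⟨y, hy, by tauto⟩
    · exact ⟨x, hx, by tauto⟩
  obtain ⟨w, hw, hwS⟩ := this
  simp only [Walk.adj_toSubgraph_iff_mem_edges]
  exact exists_two_boundary_edges_of_iff hc Iff.rfl hw hwS

/-- Attaching an ear preserves `TwoEdgeCut`. -/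
lemma TwoEdgeCut.sup_ear [DecidableEq V] {G : SimpleGraph V} {K : G.Subgraph}
    (hK : TwoEdgeCut K) {a b : V} {p : G.Walk a b} (hp : p.IsTrail)
    (ha : a ∈ K.verts) (hb : b ∈ K.verts) : TwoEdgeCut (K ⊔ p.toSubgraph) := by
  rintro S ⟨x, hx, hxS⟩ ⟨y, hy, hyS⟩
  by_cases hsep : (∃ x ∈ K.verts, x ∈ S) ∧ (∃ y ∈ K.verts, y ∉ S)
  · obtain ⟨c, d, c', d', h, h', hr⟩ := hK S hsep.1 hsep.2
    exact ⟨c, d, c', d', Or.inl h, Or.inl h', hr⟩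
  · have hside : ∀ u ∈ K.verts, (u ∈ S ↔ a ∈ S) := by
      intro u hu
      by_contra hne
      refine hsep ?_
      by_cases haS : a ∈ S
      · exact ⟨⟨a, ha, haS⟩, u, hu, by tauto⟩
      · exact ⟨⟨u, hu, by tauto⟩, a, ha, haS⟩
    rw [Subgraph.verts_sup, Set.mem_union, Walk.mem_verts_toSubgraph] at hx hy
    have : ∃ w ∈ p.support, (w ∈ S ↔ a ∉ S) := by
      by_cases haS : a ∈ S
      · exact ⟨y, hy.resolve_left fun h => hyS ((hside y h).2 haS), by tauto⟩
      · exact ⟨x, hx.resolve_left fun h => haS ((hside x h).1 hxS), by tauto⟩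
    obtain ⟨w, hw, hwS⟩ := this
    obtain ⟨c, d, c', d', h, h', hr⟩ :=
      exists_two_boundary_edges_of_iff hp (hside b hb).symm hw hwS
    exact ⟨c, d, c', d', Or.inr (Walk.adj_toSubgraph_iff_mem_edges.2 h),
      Or.inr (Walk.adj_toSubgraph_iff_mem_edges.2 h'), hr⟩

/-- Every member of an odd ear decomposition satisfies `TwoEdgeCut`. -/
lemma OddEarDecomp.twoEdgeCut [DecidableEq V] {G : SimpleGraph V} (D : OddEarDecomp G)
    (i : Fin (D.l + 1)) : TwoEdgeCut (D.Gs i) := by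
  induction i using Fin.induction with
  | zero =>
    obtain ⟨v, c, hc, -, h⟩ := D.base
    exact h ▸ twoEdgeCut_toSubgraph hc.isTrail
  | succ i ih =>
    obtain ⟨a, b, p, hp, -, ha, hb, -, -, h⟩ := D.ear i
    exact h ▸ ih.sup_ear hp.isTrail ha hb

/-- A vertex with a neighbor in a subgraph satisfying `TwoEdgeCut` has degree at least two. -/
lemma TwoEdgeCut.two_le_ncard [Finite V] {G : SimpleGraph V} {K : G.Subgraph}
    (hK : TwoEdgeCut K) {v x : V} (h : K.Adj v x) : 2 ≤ (K.neighborSet v).ncard := by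
  obtain ⟨a, b, a', b', hab, hab', ha, -, ha', -, hne⟩ :=
    hK {v} ⟨v, h.fst_mem, rfl⟩ ⟨x, h.snd_mem, fun hx => h.ne hx.symm⟩
  obtain rfl : a = v := ha
  obtain rfl : a' = a := ha'
  have hbb : b ≠ b' := fun hb => hne (by rw [hb])
  rw [← Set.ncard_pair hbb]
  exact Set.ncard_le_ncard (by rintro z (rfl | rfl) <;> assumption)

/-- Consecutive vertices of a walk of `K` are adjacent in `K`. -/
lemma adj_getVert_succ_of_edges {G : SimpleGraph V} {K : G.Subgraph} {u v : V}
    {p : G.Walk u v} (hK : ∀ e ∈ p.edges, e ∈ K.edgeSet) {i : ℕ} (hi : i < p.length) :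
    K.Adj (p.getVert i) (p.getVert (i + 1)) :=
  hK _ (Walk.adj_toSubgraph_iff_mem_edges.1 (p.toSubgraph_adj_getVert hi))

/-- The neighbors of an internal vertex of degree two of a path are its neighbors on the
path. -/
lemma eq_getVert_or_of_ncard_eq_two {G : SimpleGraph V} {K : G.Subgraph} {u v : V}
    {p : G.Walk u v} (hp : p.IsPath) (hK : ∀ e ∈ p.edges, e ∈ K.edgeSet) {i : ℕ}
    (hi : i + 1 < p.length) (h2 : (K.neighborSet (p.getVert (i + 1))).ncard = 2) {z : V}
    (hz : K.Adj (p.getVert (i + 1)) z) : z = p.getVert i ∨ z = p.getVert (i + 2) := by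
  have hne : p.getVert i ≠ p.getVert (i + 2) := fun h => by
    have := hp.getVert_injOn (by simp; omega) (by simp; omega) h
    omega
  have hsub : ({p.getVert i, p.getVert (i + 2)} : Set V) ⊆
      K.neighborSet (p.getVert (i + 1)) := by
    rintro w (rfl | rfl)
    · exact (adj_getVert_succ_of_edges hK (by omega)).symm
    · exact adj_getVert_succ_of_edges hK hi
  have hfin : (K.neighborSet (p.getVert (i + 1))).Finite :=
    Set.finite_of_ncard_ne_zero (by omega)
  have heq := Set.eq_of_subset_of_ncard_le hsub (by rw [Set.ncard_pair hne, h2]) hfin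
  have : z ∈ ({p.getVert i, p.getVert (i + 2)} : Set V) := heq ▸ hz
  simpa using this

/-- Internal vertices of an ear path have degree two. -/
lemma IsEarPath.ncard_getVert {G : SimpleGraph V} {K : G.Subgraph} {u v : V}
    {p : G.Walk u v} (hp : IsEarPath K p) {i : ℕ} (h0 : 0 < i) (hi : i < p.length) :
    (K.neighborSet (p.getVert i)).ncard = 2 := by
  refine hp.2.2.2.2.2 _ (p.getVert_mem_support i) (fun h => ?_) fun h => ?_
  · rw [hp.1.getVert_eq_start_iff hi.le] at h; omega
  · rw [hp.1.getVert_eq_end_iff hi.le] at h; omega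

/-- The ends of an ear path are distinct. -/
lemma IsEarPath.ne {G : SimpleGraph V} {K : G.Subgraph} {u v : V} {p : G.Walk u v}
    (hp : IsEarPath K p) : u ≠ v := by
  rintro rfl
  exact hp.2.1.ne' (Walk.length_eq_zero_iff.2 (Walk.isPath_iff_nil.1 hp.1))

/-- Two ear paths starting at `v` along the same edge agree as long as both last. -/
lemma IsEarPath.getVert_eq {G : SimpleGraph V} {K : G.Subgraph} {v a b : V}
    {p : G.Walk v a} {q : G.Walk v b} (hp : IsEarPath K p) (hq : IsEarPath K q)
    (h1 : p.getVert 1 = q.getVert 1) (i : ℕ) (hip : i + 1 ≤ p.length)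
    (hiq : i + 1 ≤ q.length) :
    p.getVert i = q.getVert i ∧ p.getVert (i + 1) = q.getVert (i + 1) := by
  induction i with
  | zero => simpa using h1
  | succ i ih =>
    obtain ⟨e1, e2⟩ := ih (by omega) (by omega)
    refine ⟨e2, ?_⟩
    have hadj := adj_getVert_succ_of_edges hp.2.2.1 (i := i + 1) (by omega)
    rw [e2] at hadj
    rcases eq_getVert_or_of_ncard_eq_two hq.1 hq.2.2.1 (by omega)
      (hq.ncard_getVert (by omega) (by omega)) hadj with h | h
    · rw [← e1] at h
      have := hp.1.getVert_injOn (by simp; omega) (by simp; omega) h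
      omega
    · exact h

/-- An ear path is at least as long as any ear path sharing its first dart. -/
lemma IsEarPath.length_le {G : SimpleGraph V} {K : G.Subgraph} {v a b : V}
    {p : G.Walk v a} {q : G.Walk v b} (hp : IsEarPath K p) (hq : IsEarPath K q)
    (h1 : p.getVert 1 = q.getVert 1) : q.length ≤ p.length := by
  by_contra! hlt
  have hpos := hp.2.1
  obtain ⟨-, h⟩ := hp.getVert_eq hq h1 (p.length - 1) (by omega) (by omega)
  rw [Nat.sub_add_cancel hpos, Walk.getVert_length] at h
  have h2 := hq.ncard_getVert hpos hlt
  have h3 : (K.neighborSet a).ncard = 3 := hp.2.2.2.2.1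
  rw [h] at h3
  omega

/-- An ear path is determined by its first dart. -/
lemma IsEarPath.sigma_eq {G : SimpleGraph V} {K : G.Subgraph} {v a b : V}
    {p : G.Walk v a} {q : G.Walk v b} (hp : IsEarPath K p) (hq : IsEarPath K q)
    (h1 : p.getVert 1 = q.getVert 1) :
    (⟨a, p⟩ : Σ w : V, G.Walk v w) = ⟨b, q⟩ := by
  have hlen : p.length = q.length :=
    le_antisymm (hq.length_le hp h1.symm) (hp.length_le hq h1)
  have hpos := hp.2.1
  have hend : a = b := by
    obtain ⟨-, h⟩ := hp.getVert_eq hq h1 (p.length - 1) (by omega) (by omega)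
    rw [Nat.sub_add_cancel hpos, Walk.getVert_length, hlen, Walk.getVert_length] at h
    exact h
  subst hend
  congr 1
  refine Walk.ext_getVert fun k => ?_
  rcases k with _ | k
  · simp
  rcases le_or_gt (k + 1) p.length with hk | hk
  · exact (hp.getVert_eq hq h1 k hk (by omega)).2
  · rw [Walk.getVert_of_length_le _ hk.le, Walk.getVert_of_length_le _ (by omega)]

/-- Along every edge at a vertex of degree three there starts an ear path. -/
lemma TwoEdgeCut.exists_isEarPath [Fintype V] [DecidableEq V] {G : SimpleGraph V}
    {K : G.Subgraph} (hK : TwoEdgeCut K) (h3 : ∀ u, (K.neighborSet u).ncard ≤ 3)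
    {v x : V} (hv : v ∈ deg3 K) (hx : K.Adj v x) :
    ∃ (w : V) (p : G.Walk v w), IsEarPath K p ∧ p.getVert 1 = x := by
  have key : ∀ n : ℕ, ∀ (w : V) (p : G.Walk v w), p.IsPath → 0 < p.length →
      (∀ e ∈ p.edges, e ∈ K.edgeSet) →
      (∀ i, 0 < i → i < p.length → (K.neighborSet (p.getVert i)).ncard = 2) →
      p.getVert 1 = x → Fintype.card V ≤ p.length + n →
      ∃ (w : V) (p : G.Walk v w), IsEarPath K p ∧ p.getVert 1 = x := by
    intro n
    induction n with
    | zero =>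
      intro w p hp _ _ _ _ hcard
      have := hp.length_lt
      omega
    | succ n ih =>
      intro w p hp hpos hpK hint h1 hcard
      have hpen : K.Adj w (p.getVert (p.length - 1)) := by
        have h := adj_getVert_succ_of_edges hpK (i := p.length - 1) (by omega)
        rw [Nat.sub_add_cancel hpos, Walk.getVert_length] at h
        exact h.symm
      have hdeg := hK.two_le_ncard hpen
      by_cases hw3 : (K.neighborSet w).ncard = 3
      · refine ⟨w, p, ⟨hp, hpos, hpK, hv, hw3, fun u hu huv huw => ?_⟩, h1⟩
        obtain ⟨i, rfl, hi⟩ := Walk.mem_support_iff_exists_getVert.1 hu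
        refine hint i (Nat.pos_of_ne_zero ?_) (lt_of_le_of_ne hi ?_)
        · rintro rfl; simp at huv
        · rintro rfl; simp at huw
      have hw2 : (K.neighborSet w).ncard = 2 := by have := h3 w; omega
      obtain ⟨t, ht, htne⟩ :=
        Set.exists_ne_of_one_lt_ncard (by omega : 1 < (K.neighborSet w).ncard)
          (p.getVert (p.length - 1))
      replace ht : K.Adj w t := ht
      by_cases hts : t ∈ p.support
      · exfalso
        obtain ⟨i, hit, hi⟩ := Walk.mem_support_iff_exists_getVert.1 hts
        have hin : i ≠ p.length := by
          rintro rfl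
          rw [Walk.getVert_length] at hit
          exact ht.ne hit
        have hin' : i ≠ p.length - 1 := by rintro rfl; exact htne hit.symm
        have hi0 : i = 0 := by
          rcases i with _ | i
          · rfl
          exfalso
          have hadj : K.Adj (p.getVert (i + 1)) w := hit ▸ ht.symm
          rcases eq_getVert_or_of_ncard_eq_two hp hpK (by omega)
            (hint _ (by omega) (by omega)) hadj with h | h
          · have := (hp.getVert_eq_end_iff (by omega)).1 h.symm
            omega
          · have := (hp.getVert_eq_end_iff (by omega)).1 h.symm
            omega
        subst hi0
        rw [Walk.getVert_zero] at hit
        subst hit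
        have hxw : x ≠ w := by
          rintro rfl
          have := (hp.getVert_eq_end_iff (by omega)).1 h1
          omega
        have hcl : ∀ j, 0 < j → j ≤ p.length → ∀ z, K.Adj (p.getVert j) z →
            z ∈ p.support := by
          intro j hj0 hj z hz
          rcases hj.lt_or_eq with hlt | rfl
          · obtain ⟨j, rfl⟩ : ∃ k, j = k + 1 := ⟨j - 1, by omega⟩
            rcases eq_getVert_or_of_ncard_eq_two hp hpK hlt (hint _ hj0 hlt) hz with h | h
            · exact h ▸ p.getVert_mem_support _
            · exact h ▸ p.getVert_mem_support _
          · rw [Walk.getVert_length] at hz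
            have hsub : ({p.getVert (p.length - 1), v} : Set V) ⊆ K.neighborSet w := by
              rintro u (rfl | rfl)
              · exact hpen
              · exact ht
            have heq := Set.eq_of_subset_of_ncard_le hsub
              (by rw [Set.ncard_pair htne.symm, hw2])
            have : z ∈ ({p.getVert (p.length - 1), v} : Set V) := heq ▸ hz
            rcases this with rfl | rfl
            · exact p.getVert_mem_support _
            · exact p.start_mem_support
        have hvS : ∀ {a b : V}, K.Adj a b → a ∈ p.support → b ∉ p.support → a = v := by
          intro a b hab ha hb
          obtain ⟨j, rfl, hj⟩ := Walk.mem_support_iff_exists_getVert.1 ha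
          rcases Nat.eq_zero_or_pos j with rfl | hj0
          · simp
          · exact absurd (hcl j hj0 hj b hab) hb
        have hxs : x ∈ p.support := h1 ▸ p.getVert_mem_support 1
        have hv3 : (K.neighborSet v).ncard = 3 := hv
        have hrest : (K.neighborSet v \ {x, w}).ncard = 1 := by
          rw [Set.ncard_sdiff (by rintro u (rfl | rfl); exacts [hx, ht.symm]),
            Set.ncard_pair hxw, hv3]
        obtain ⟨y, hy⟩ := Set.ncard_eq_one.1 hrest
        have hyv : y ∈ K.neighborSet v \ {x, w} := hy ▸ rfl
        have hyS : y ∉ p.support := by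
          intro hys
          obtain ⟨j, rfl, hj⟩ := Walk.mem_support_iff_exists_getVert.1 hys
          have hjv : K.Adj v (p.getVert j) := hyv.1
          have hjx : j ≠ 1 := by rintro rfl; exact hyv.2 (Or.inl h1)
          have hjw : j ≠ p.length := by
            rintro rfl; exact hyv.2 (Or.inr (by simp))
          have hj0 : j ≠ 0 := by rintro rfl; exact hjv.ne (by simp)
          obtain ⟨j, rfl⟩ : ∃ k, j = k + 1 := ⟨j - 1, by omega⟩
          rcases eq_getVert_or_of_ncard_eq_two hp hpK (by omega)
            (hint _ (by omega) (by omega)) hjv.symm with h | h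
          · have := (hp.getVert_eq_start_iff (by omega)).1 h.symm
            omega
          · have := (hp.getVert_eq_start_iff (by omega)).1 h.symm
            omega
        have hbd : ∀ {b : V}, K.Adj v b → b ∉ p.support → b = y := by
          intro b hb hbS
          have : b ∈ K.neighborSet v \ {x, w} := by
            refine ⟨hb, ?_⟩
            rintro (rfl | rfl)
            · exact hbS hxs
            · exact hbS p.end_mem_support
          rw [hy] at this
          exact this
        obtain ⟨a, b, a', b', hab, hab', ha, hb, ha', hb', hne⟩ :=
          hK {u | u ∈ p.support} ⟨v, hx.fst_mem, p.start_mem_support⟩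
            ⟨y, K.edge_vert hyv.1.symm, hyS⟩
        obtain rfl := hvS hab ha hb
        obtain rfl := hvS hab' ha' hb'
        exact hne (by rw [hbd hab hb, hbd hab' hb'])
      · refine ih t (p.concat ht.adj_sub) (hp.concat hts _) (by simp) ?_ ?_ ?_ ?_
        · intro e he
          rw [Walk.edges_concat, List.concat_eq_append, List.mem_append,
            List.mem_singleton] at he
          rcases he with he | rfl
          · exact hpK e he
          · exact ht
        · intro i hi0 hi
          rw [Walk.length_concat] at hi
          have hget : (p.concat ht.adj_sub).getVert i = p.getVert i := by
            rw [Walk.concat_eq_append, Walk.getVert_append]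
            split_ifs with h
            · rfl
            · obtain rfl : i = p.length := by omega
              simp
          rw [hget]
          rcases (Nat.lt_succ_iff.1 hi).lt_or_eq with h | rfl
          · exact hint i hi0 h
          · simpa using hw2
        · rw [Walk.concat_eq_append, Walk.getVert_append]
          split_ifs with h
          · exact h1
          · have hl : p.length = 1 := by omega
            rw [hl, Nat.sub_self, Walk.getVert_zero, ← h1, ← hl, Walk.getVert_length]
        · rw [Walk.length_concat]; omega
  refine key (Fintype.card V) x (Walk.cons hx.adj_sub Walk.nil) ?_ (by simp) ?_ ?_ (by simp)
    (by omega)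
  · simpa using hx.ne
  · intro e he
    simp at he
    exact he ▸ hx
  · intro i hi0 hi
    simp at hi
    omega

section Count

variable {G : SimpleGraph V} {K : G.Subgraph} {M : Set (Sym2 V)}

/-- The neighbors of `(v, j)` along the projected path of `p`. -/
def prNbrs (E : EarSquareGraph G K M) {v w : V} (p : G.Walk v w) (j : ZMod 4) :
    Set (V × ZMod 4) :=
  {q | s((v, j), q) ∈ E.pr p}

/-- The projected path of an ear path at `v` covers two consecutive vertices of the square
`s_v`, each by one edge. -/
lemma exists_support (E : EarSquareGraph G K M) {v w : V} {p : G.Walk v w}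
    (hp : IsEarPath K p) : ∃ a : ZMod 4,
      (∀ j, (prNbrs E p j).ncard = if j = a ∨ j = a + 1 then 1 else 0) ∧
      (∀ j, (v, j) ∈ sqSupp v (E.pr p) ↔ j = a ∨ j = a + 1) ∧
      ∀ j, ∀ q ∈ prNbrs E p j, q.1 = w := by
  have hne := hp.ne
  have h1 : ∀ a : ZMod 4, a + 1 ≠ a := by decide
  have h1' : ∀ a : ZMod 4, a ≠ a + 1 := by decide
  obtain ⟨a, k, k', h⟩ : ∃ a k k' : ZMod 4,
      E.pr p = {s((v, a), (w, k)), s((v, a + 1), (w, k'))} := by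
    obtain ⟨a, k, h | h⟩ := E.pr_shape p hp
    exacts [⟨a, k, _, h⟩, ⟨a, k, _, h⟩]
  have hset : ∀ j q, q ∈ prNbrs E p j ↔
      (j = a ∧ q = (w, k)) ∨ (j = a + 1 ∧ q = (w, k')) := by
    intro j q
    simp only [prNbrs, h, Set.mem_ofPred_eq, Set.mem_insert_iff, Set.mem_singleton_iff,
      Sym2.eq_iff, Prod.mk.injEq]
    tauto
  refine ⟨a, fun j => ?_, fun j => ?_, fun j q hq => ?_⟩
  · by_cases hj : j = a
    · have : prNbrs E p j = {(w, k)} := by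
        ext q; rw [hset]; subst hj; simp [h1']
      rw [this, Set.ncard_singleton, if_pos (Or.inl hj)]
    · by_cases hj' : j = a + 1
      · have : prNbrs E p j = {(w, k')} := by
          ext q; rw [hset]; subst hj'; simp [h1]
        rw [this, Set.ncard_singleton, if_pos (Or.inr hj')]
      · have : prNbrs E p j = ∅ := by
          ext q; rw [hset]; simp [hj, hj']
        simp [this, hj, hj']
  · simp [sqSupp, h, hne]
  · rcases (hset j q).1 hq with ⟨-, rfl⟩ | ⟨-, rfl⟩ <;> rfl

/-- Distinct ear paths at `v` lead `(v, j)` to distinct neighbors. -/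
lemma disjoint_prNbrs (E : EarSquareGraph G K M) {v w w' : V} {p : G.Walk v w}
    {q : G.Walk v w'} (hp : IsEarPath K p) (hq : IsEarPath K q)
    (hne : p.getVert 1 ≠ q.getVert 1) (j : ZMod 4) :
    Disjoint (prNbrs E p j) (prNbrs E q j) := by
  have hd : Disjoint (E.pr p) (E.pr q) := by
    refine E.pr_disjoint p q hp hq (fun h => hne ?_) fun h => ?_
    · have h' := congrArg (fun s : Σ a b : V, G.Walk a b => s.2.2.getVert 1) h
      exact h'
    · exact hq.ne (congrArg (fun s : Σ a b : V, G.Walk a b => s.1) h)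
  rw [Set.disjoint_left] at hd ⊢
  exact fun x hx hx' => hd hx hx'

/-- The neighborhood of a vertex of a square: two neighbors within the square, and those
along the three ear paths. -/
lemma neighborSet_eq (E : EarSquareGraph G K M) {v m y z wm wy wz : V} (hv : v ∈ deg3 K)
    (hnbr : ∀ u, K.Adj v u → u = m ∨ u = y ∨ u = z)
    {pm : G.Walk v wm} {py : G.Walk v wy} {pz : G.Walk v wz}
    (hpm : IsEarPath K pm) (hpy : IsEarPath K py) (hpz : IsEarPath K pz)
    (em : pm.getVert 1 = m) (ey : py.getVert 1 = y) (ez : pz.getVert 1 = z) (j : ZMod 4) :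
    E.Q.neighborSet (v, j) = ((({(v, j + 1), (v, j + 3)} : Set (V × ZMod 4)) ∪
      prNbrs E pm j) ∪ prNbrs E py j) ∪ prNbrs E pz j := by
  have hout : ∀ {w : V} {p : G.Walk v w}, IsEarPath K p → ∀ k,
      (v, k) ∉ prNbrs E p j := by
    intro w p hp k hk
    obtain ⟨-, -, -, h⟩ := exists_support E hp
    exact hp.ne (h j _ hk)
  have hin : ∀ {w : V} {p : G.Walk v w}, IsEarPath K p → ∀ q ∈ prNbrs E p j,
      E.Q.Adj (v, j) q := by
    rintro w p hp ⟨u, k⟩ hq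
    obtain ⟨-, -, -, h⟩ := exists_support E hp
    obtain rfl : u = w := h j _ hq
    exact (E.inter _ _ _ _ hp.ne).2 ⟨p, hp, hq⟩
  have h4 : ∀ j k : ZMod 4, (k = j + 1 ∨ j = k + 1) ↔ (k = j + 1 ∨ k = j + 3) := by
    decide
  ext ⟨u, k⟩
  simp only [mem_neighborSet, Set.mem_union, Set.mem_insert_iff, Set.mem_singleton_iff,
    Prod.mk.injEq]
  by_cases huv : u = v
  · subst huv
    simp [E.intra u hv, h4, hout hpm, hout hpy, hout hpz]
  · constructor
    · intro hadj
      obtain ⟨p, hp, hmem⟩ := (E.inter _ _ _ _ (Ne.symm huv)).1 hadj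
      have hfirst : K.Adj v (p.getVert 1) := by
        simpa using adj_getVert_succ_of_edges hp.2.2.1 hp.2.1
      have htrans : ∀ {w : V} {q : G.Walk v w}, IsEarPath K q →
          p.getVert 1 = q.getVert 1 → (u, k) ∈ prNbrs E q j := by
        intro w q hq h
        have hs := hp.sigma_eq hq h
        cases hs
        exact hmem
      rcases hnbr _ hfirst with h | h | h
      · exact Or.inl (Or.inl (Or.inr (htrans hpm (h.trans em.symm))))
      · exact Or.inl (Or.inr (htrans hpy (h.trans ey.symm)))
      · exact Or.inr (htrans hpz (h.trans ez.symm))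
    · rintro (((h | h) | h) | h)
      · tauto
      · exact hin hpm _ h
      · exact hin hpy _ h
      · exact hin hpz _ h

end Count

/-- The positions of the degrees four and three in a square with one doubly covered edge. -/
lemma existsUnique_degree_pattern {f : ZMod 4 → ℕ} {a b c : ZMod 4}
    (hbc : ∀ j, ¬((j = b ∨ j = b + 1) ∧ (j = c ∨ j = c + 1)))
    (hf : ∀ j, f j = 2 + (if j = a ∨ j = a + 1 then 1 else 0) +
      (if j = b ∨ j = b + 1 then 1 else 0) + (if j = c ∨ j = c + 1 then 1 else 0)) :
    ∃! j : ZMod 4, f j = 4 ∧ f (j + 1) = 4 ∧ f (j + 2) = 3 ∧ f (j + 3) = 3 := by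
  simp only [hf]
  clear hf
  revert a b c
  unfold ExistsUnique
  decide

/-- in any `(G_i, M)`-ear square graph, each square `s_v` has a unique
`j ∈ ZMod 4` such that `v_j, v_{j+1}` have degree 4 and `v_{j+2}, v_{j+3}` have
degree 3. -/
theorem stmt19 {V : Type} [Fintype V] [DecidableEq V] (G : SimpleGraph V)
    (hG : IsCubic G) (hB : Bridgeless G) (D : OddEarDecomp G)
    (M : G.Subgraph) (hM : M.IsPerfectMatching) (hAbs : AbsoluteIn M D)
    (i : ℕ) (h1 : 1 ≤ i) (hil : i ≤ D.l)
    (E : EarSquareGraph G (D.Gs ⟨i, by omega⟩) M.edgeSet) :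
    ∀ v ∈ deg3 (D.Gs ⟨i, by omega⟩), ∃! j : ZMod 4,
      (E.Q.neighborSet (v, j)).ncard = 4 ∧
      (E.Q.neighborSet (v, j + 1)).ncard = 4 ∧
      (E.Q.neighborSet (v, j + 2)).ncard = 3 ∧
      (E.Q.neighborSet (v, j + 3)).ncard = 3 := by
  have hK := D.twoEdgeCut ⟨i, by omega⟩
  have hA := hAbs ⟨i, by omega⟩
  revert E hK hA
  generalize D.Gs ⟨i, by omega⟩ = K
  intro E hK hA v hv
  have h3 : ∀ u, (K.neighborSet u).ncard ≤ 3 := fun u =>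
    (Set.ncard_le_ncard (K.neighborSet_subset u)).trans (hG u).le
  have hv3 : (K.neighborSet v).ncard = 3 := hv
  obtain ⟨x, hx⟩ := Set.nonempty_of_ncard_ne_zero (s := K.neighborSet v) (by omega)
  obtain ⟨m, ⟨hMm, hKm⟩, -⟩ := hA v (K.edge_vert hx)
  have hrest : (K.neighborSet v \ {m}).ncard = 2 := by
    rw [Set.ncard_sdiff_singleton_of_mem (s := K.neighborSet v) hKm, hv3]
  obtain ⟨y, z, hyz, hset⟩ := Set.ncard_eq_two.1 hrest
  have hy : y ∈ K.neighborSet v \ {m} := hset ▸ Or.inl rfl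
  have hz : z ∈ K.neighborSet v \ {m} := hset ▸ Or.inr rfl
  have hym : y ≠ m := hy.2
  have hzm : z ≠ m := hz.2
  have hnbr : ∀ u, K.Adj v u → u = m ∨ u = y ∨ u = z := by
    intro u hu
    by_cases hum : u = m
    · exact Or.inl hum
    · have : u ∈ K.neighborSet v \ {m} := ⟨hu, hum⟩
      rw [hset] at this
      exact Or.inr this
  obtain ⟨wm, pm, hpm, em⟩ := hK.exists_isEarPath h3 hv hKm
  obtain ⟨wy, py, hpy, ey⟩ := hK.exists_isEarPath h3 hv hy.1
  obtain ⟨wz, pz, hpz, ez⟩ := hK.exists_isEarPath h3 hv hz.1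
  obtain ⟨a, ha, -, ham⟩ := exists_support E hpm
  obtain ⟨b, hb, hbs, hbm⟩ := exists_support E hpy
  obtain ⟨c, hc, hcs, hcm⟩ := exists_support E hpz
  have hmat : Disjoint (sqSupp v (E.pr py)) (sqSupp v (E.pr pz)) := by
    refine E.matched v wy wz py pz hpy hpz (by rwa [ey, ez]) fun w hw => ?_
    obtain rfl : w = m := (hM.1 (hM.2 v)).unique hw hMm
    exact ⟨ey ▸ hym, ez ▸ hzm⟩
  refine existsUnique_degree_pattern (a := a) (b := b) (c := c)
    (f := fun j => (E.Q.neighborSet (v, j)).ncard) (fun j hj => ?_) fun j => ?_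
  · exact Set.disjoint_left.1 hmat ((hbs j).2 hj.1) ((hcs j).2 hj.2)
  · have hpair : ((v, j + 1) : V × ZMod 4) ≠ (v, j + 3) := by
      have : ∀ j : ZMod 4, j + 1 ≠ j + 3 := by decide
      simpa using this j
    have hdis : ∀ {w : V} {p : G.Walk v w}, IsEarPath K p →
        (∀ j, ∀ q ∈ prNbrs E p j, q.1 = w) →
        Disjoint ({(v, j + 1), (v, j + 3)} : Set (V × ZMod 4)) (prNbrs E p j) := by
      intro w p hp hw
      rw [Set.disjoint_left]
      rintro q (rfl | rfl) hq
      · exact hp.ne (hw j _ hq)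
      · exact hp.ne (hw j _ hq)
    have hmy := disjoint_prNbrs E hpm hpy (by rw [em, ey]; exact hym.symm) j
    have hmz := disjoint_prNbrs E hpm hpz (by rw [em, ez]; exact hzm.symm) j
    have hyz' := disjoint_prNbrs E hpy hpz (by rwa [ey, ez]) j
    simp only [neighborSet_eq E hv hnbr hpm hpy hpz em ey ez j]
    rw [Set.ncard_union_eq (Set.disjoint_union_left.2
        ⟨Set.disjoint_union_left.2 ⟨hdis hpz hcm, hmz⟩, hyz'⟩),
      Set.ncard_union_eq (Set.disjoint_union_left.2 ⟨hdis hpy hbm, hmy⟩),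
      Set.ncard_union_eq (hdis hpm ham), Set.ncard_pair hpair, ha, hb, hc]

end Hex
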